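/- arXiv:2601.07545 — 2 statements merged into one kernel-verified Lean document; each statement's English description precedes it below -/
import Mathlib

section
/- Let χ ∈ (0, 1/2], k ∈ ℕ with k ≥ 1, A ∈ ℝ^{n×d} with A^⊤A positive definite, b ∈ ℝ^n, θ₀ ∈ ℝ^d, and B ∈ ℝ^{k×n} satisfying both: (i) |u^⊤((1/k)·B^⊤B − I_n)Av| ≤ (χ/2)·‖u‖·‖Av‖ for all u ∈ ℝ^n and v ∈ ℝ^d; and (ii) ‖BAv‖² ≥ k·(1−χ)·‖Av‖² for all v ∈ ℝ^d. Define θ*(A,b) := (A^⊤A)^{-1}A^⊤b and θ̂ := θ₀ + ((1/k)·A^⊤B^⊤BA)^{-1}·A^⊤(b − Aθ₀). Then ‖θ̂ − θ*(A,b)‖²_{A^⊤A} ≤ χ² · ‖θ₀ − θ*(A,b)‖²_{A^⊤A}. -/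
open Matrix

/-- Sketching condition `A₁(A,χ,k)`:
`|uᵀ((1/k)·BᵀB − I)Av| ≤ (χ/2)·‖u‖·‖Av‖` for all `u, v`. -/
def condA1 {κ m δ : Type*} [Fintype κ] [Fintype m] [DecidableEq m] [Fintype δ]
    (A : Matrix m δ ℝ) (χ : ℝ) (k : ℕ) (B : Matrix κ m ℝ) : Prop :=
  ∀ (u : m → ℝ) (v : δ → ℝ),
    |u ⬝ᵥ ((((k : ℝ)⁻¹ • (Bᵀ * B)) - 1) *ᵥ (A *ᵥ v))| ≤
      (χ / 2) * Real.sqrt (u ⬝ᵥ u) * Real.sqrt ((A *ᵥ v) ⬝ᵥ (A *ᵥ v))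

/-- Sketching condition `A₂(A,χ,k)`: `‖BAv‖² ≥ k·(1−χ)·‖Av‖²` for all `v`. -/
def condA2 {κ m δ : Type*} [Fintype κ] [Fintype m] [Fintype δ]
    (A : Matrix m δ ℝ) (χ : ℝ) (k : ℕ) (B : Matrix κ m ℝ) : Prop :=
  ∀ v : δ → ℝ,
    ((B * A) *ᵥ v) ⬝ᵥ ((B * A) *ᵥ v) ≥ (k : ℝ) * (1 - χ) * ((A *ᵥ v) ⬝ᵥ (A *ᵥ v))

/-- The quadratic form of a Gram matrix is the squared norm of the image. -/
theorem dotProduct_transpose_mul_self_mulVec {m δ : Type*} [Fintype m] [Fintype δ]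
    (A : Matrix m δ ℝ) (v w : δ → ℝ) :
    v ⬝ᵥ ((Aᵀ * A) *ᵥ w) = (A *ᵥ v) ⬝ᵥ (A *ᵥ w) := by
  rw [← mulVec_mulVec, dotProduct_mulVec, vecMul_transpose]

/-- Condition `A₂` bounds the sketched Gram form from below. -/
theorem condA2.le_sketched_form {κ m δ : Type*} [Fintype κ] [Fintype m] [Fintype δ]
    {A : Matrix m δ ℝ} {χ : ℝ} {k : ℕ} {B : Matrix κ m ℝ} (hB : condA2 A χ k B) (hk : 1 ≤ k)
    (v : δ → ℝ) :
    (1 - χ) * ((A *ᵥ v) ⬝ᵥ (A *ᵥ v)) ≤ v ⬝ᵥ (((k : ℝ)⁻¹ • (Aᵀ * Bᵀ * B * A)) *ᵥ v) := by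
  have hk0 : (0 : ℝ) < k := by exact_mod_cast hk
  have hmul : Aᵀ * Bᵀ * B * A = (B * A)ᵀ * (B * A) := by
    rw [transpose_mul, Matrix.mul_assoc (Aᵀ * Bᵀ)]
  rw [hmul, smul_mulVec, dotProduct_smul, dotProduct_transpose_mul_self_mulVec, smul_eq_mul,
    le_inv_mul_iff₀ hk0, ← mul_assoc]
  exact hB v

/-- Under condition `A₂` with `χ < 1`, the sketched Gram matrix is invertible. -/
theorem condA2.isUnit_det {κ m δ : Type*} [Fintype κ] [Fintype m] [Fintype δ] [DecidableEq δ]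
    {A : Matrix m δ ℝ} {χ : ℝ} {k : ℕ} {B : Matrix κ m ℝ} (hB : condA2 A χ k B) (hk : 1 ≤ k)
    (hχ : χ < 1) (hA : (Aᵀ * A).PosDef) :
    IsUnit ((k : ℝ)⁻¹ • (Aᵀ * Bᵀ * B * A)).det := by
  rw [isUnit_iff_ne_zero]
  intro hdet
  obtain ⟨v, hv, hHv⟩ := exists_mulVec_eq_zero_iff.mpr hdet
  have hle := hB.le_sketched_form hk v
  rw [hHv, dotProduct_zero] at hle
  have hpos : 0 < (A *ᵥ v) ⬝ᵥ (A *ᵥ v) := by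
    simpa [dotProduct_transpose_mul_self_mulVec] using hA.dotProduct_mulVec_pos hv
  nlinarith

/-- under conditions `A₁(A,χ,k)` and `A₂(A,χ,k)` with `χ ∈ (0, 1/2]`, the
iterate `θ̂ = θ₀ + ((1/k)·AᵀBᵀBA)⁻¹Aᵀ(b − Aθ₀)` satisfies
`‖θ̂ − θ*(A,b)‖²_{AᵀA} ≤ χ²·‖θ₀ − θ*(A,b)‖²_{AᵀA}`. -/
theorem stmt9 {n d k : ℕ} (hk : 1 ≤ k) (χ : ℝ) (hχ : χ ∈ Set.Ioc (0 : ℝ) (1 / 2))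
    (A : Matrix (Fin n) (Fin d) ℝ) (hA : (Aᵀ * A).PosDef)
    (b : Fin n → ℝ) (θ0 : Fin d → ℝ)
    (B : Matrix (Fin k) (Fin n) ℝ) (hB1 : condA1 A χ k B) (hB2 : condA2 A χ k B) :
    let θs : Fin d → ℝ := (Aᵀ * A)⁻¹ *ᵥ (Aᵀ *ᵥ b)
    let θhat : Fin d → ℝ :=
      θ0 + ((k : ℝ)⁻¹ • (Aᵀ * Bᵀ * B * A))⁻¹ *ᵥ (Aᵀ *ᵥ (b - A *ᵥ θ0))
    (θhat - θs) ⬝ᵥ ((Aᵀ * A) *ᵥ (θhat - θs)) ≤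
      χ ^ 2 * ((θ0 - θs) ⬝ᵥ ((Aᵀ * A) *ᵥ (θ0 - θs))) := by
  intro θs θhat
  obtain ⟨hχ0, hχ1⟩ := hχ
  set H := (k : ℝ)⁻¹ • (Aᵀ * Bᵀ * B * A) with hH
  have hHdet : IsUnit H.det := hB2.isUnit_det hk (by linarith) hA
  have hnormal : (Aᵀ * A) *ᵥ θs = Aᵀ *ᵥ b := by
    rw [mulVec_mulVec, mul_nonsing_inv _ hA.det_pos.ne'.isUnit, one_mulVec]
  have herr : H *ᵥ (θhat - θs) = H *ᵥ (θ0 - θs) - (Aᵀ * A) *ᵥ (θ0 - θs) := by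
    have hstep : H *ᵥ (θhat - θ0) = Aᵀ *ᵥ b - (Aᵀ * A) *ᵥ θ0 := by
      rw [add_sub_cancel_left, mulVec_mulVec, mul_nonsing_inv _ hHdet, one_mulVec, mulVec_sub,
        mulVec_mulVec]
    rw [← sub_add_sub_cancel θhat θ0 θs, mulVec_add, hstep, mulVec_sub (Aᵀ * A), hnormal]
    abel
  have hform : (θhat - θs) ⬝ᵥ (H *ᵥ (θhat - θs)) =
      (A *ᵥ (θhat - θs)) ⬝ᵥ ((((k : ℝ)⁻¹ • (Bᵀ * B)) - 1) *ᵥ (A *ᵥ (θ0 - θs))) := by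
    have hfactor : H - Aᵀ * A = Aᵀ * ((((k : ℝ)⁻¹ • (Bᵀ * B)) - 1) * A) := by
      simp [hH, Matrix.sub_mul, Matrix.mul_sub, Matrix.mul_assoc]
    rw [herr, ← sub_mulVec, hfactor, ← mulVec_mulVec, dotProduct_mulVec, vecMul_transpose,
      mulVec_mulVec]
  have hlower := hB2.le_sketched_form hk (θhat - θs)
  have hupper := (le_abs_self _).trans (hB1 (A *ᵥ (θhat - θs)) (θ0 - θs))
  rw [← hH, hform] at hlower
  rw [dotProduct_transpose_mul_self_mulVec, dotProduct_transpose_mul_self_mulVec]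
  have hx0 : 0 ≤ (A *ᵥ (θhat - θs)) ⬝ᵥ (A *ᵥ (θhat - θs)) :=
    dotProduct_self_star_nonneg (A *ᵥ (θhat - θs))
  have hy0 : 0 ≤ (A *ᵥ (θ0 - θs)) ⬝ᵥ (A *ᵥ (θ0 - θs)) :=
    dotProduct_self_star_nonneg (A *ᵥ (θ0 - θs))
  have hbound := hlower.trans hupper
  generalize (A *ᵥ (θhat - θs)) ⬝ᵥ (A *ᵥ (θhat - θs)) = x at hx0 hbound ⊢
  generalize (A *ᵥ (θ0 - θs)) ⬝ᵥ (A *ᵥ (θ0 - θs)) = y at hy0 hbound ⊢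
  have hsx := Real.sqrt_nonneg x
  have hsy := Real.sqrt_nonneg y
  have hx := Real.sq_sqrt hx0
  have hy := Real.sq_sqrt hy0
  have hsqrt : √x ≤ χ * √y := by
    rcases hsx.eq_or_lt with h | h
    · rw [← h]
      positivity
    · refine le_of_mul_le_mul_left ?_ h
      nlinarith
  calc x = √x ^ 2 := hx.symm
    _ ≤ (χ * √y) ^ 2 := by gcongr
    _ = χ ^ 2 * y := by rw [mul_pow, hy]
end

section
/- Let X ∈ ℝ^{n×d} have rows x_1,…,x_n with ‖x_i‖ ≤ 1 for all i, with M := X^⊤X positive definite, and let Y ∈ ℝ^n with ‖Y‖_∞ ≤ C_Y. Let θ* := M^{-1}X^⊤Y, κ(M) := λ_max(M)/λ_min(M), and let χ, ϱ ∈ (0,1], σ ≥ 0, k ∈ ℕ with k ≥ 1, T ∈ ℕ with T ≥ 1 be such that χ·√κ(M)/(2 − χ) < 1. Suppose matrices B_0,…,B_{T−1} ∈ ℝ^{k×n} each satisfy the conditions A₁(X,χ,k) and A₂(X,χ,k), and vectors v_0,…,v_{T−1} ∈ ℝ^d each satisfy ‖v_t‖² ≤ (√(2d) + √(4·log(2T/ϱ)))².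 Define θ̂_0 := 0 and θ̂_{t+1} := θ̂_t + ((1/k)·X^⊤B_t^⊤B_tX)^{-1}·(X^⊤(Y − Xθ̂_t) + σ·v_t). Then for every t with 0 ≤ t ≤ T−1: ‖Y − Xθ̂_t‖_∞ ≤ C_Y + (1 + (χ·√κ(M)/(2 − χ))^t)·‖θ*‖ + (2σ/(2 − χ(1 + √κ(M)))) · (√(2d) + √(4·log(2T/ϱ))) / λ_min(M). -/
open Matrix

/-- The smallest eigenvalue of a real symmetric matrix, characterized as the infimum of
`v ⬝ᵥ M *ᵥ v` over (Euclidean) unit vectors `v`. -/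
noncomputable def lambdaMin {d : ℕ} (M : Matrix (Fin d) (Fin d) ℝ) : ℝ :=
  sInf {r : ℝ | ∃ v : Fin d → ℝ, v ⬝ᵥ v = 1 ∧ r = v ⬝ᵥ (M *ᵥ v)}

/-- The largest eigenvalue of a real symmetric matrix, characterized as the supremum of
`v ⬝ᵥ M *ᵥ v` over (Euclidean) unit vectors `v`. -/
noncomputable def lambdaMax {d : ℕ} (M : Matrix (Fin d) (Fin d) ℝ) : ℝ :=
  sSup {r : ℝ | ∃ v : Fin d → ℝ, v ⬝ᵥ v = 1 ∧ r = v ⬝ᵥ (M *ᵥ v)}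

lemma sqrt_dotProduct_self_eq_norm {ι : Type*} [Fintype ι] (x : ι → ℝ) :
    Real.sqrt (x ⬝ᵥ x) = ‖WithLp.toLp 2 x‖ := by
  rw [EuclideanSpace.norm_eq]
  simp [dotProduct, pow_two]

lemma sqrt_dotProduct_self_add_le {ι : Type*} [Fintype ι] (x y : ι → ℝ) :
    Real.sqrt ((x + y) ⬝ᵥ (x + y)) ≤ Real.sqrt (x ⬝ᵥ x) + Real.sqrt (y ⬝ᵥ y) := by
  simp only [sqrt_dotProduct_self_eq_norm, WithLp.toLp_add]
  exact norm_add_le _ _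

lemma abs_dotProduct_le_sqrt_mul_sqrt {ι : Type*} [Fintype ι] (x y : ι → ℝ) :
    |x ⬝ᵥ y| ≤ Real.sqrt (x ⬝ᵥ x) * Real.sqrt (y ⬝ᵥ y) := by
  simp only [sqrt_dotProduct_self_eq_norm]
  have h := abs_real_inner_le_norm (WithLp.toLp 2 y) (WithLp.toLp 2 x)
  rw [EuclideanSpace.inner_toLp_toLp, star_trivial, mul_comm] at h
  exact h

lemma dotProduct_self_nonneg_real {ι : Type*} [Fintype ι] (x : ι → ℝ) : 0 ≤ x ⬝ᵥ x :=
  Finset.sum_nonneg fun i _ => mul_self_nonneg (x i)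

lemma isCompact_unit_dotProduct (d : ℕ) : IsCompact {v : Fin d → ℝ | v ⬝ᵥ v = 1} := by
  refine Metric.isCompact_of_isClosed_isBounded
    (isClosed_eq (by fun_prop) continuous_const) ?_
  refine (Metric.isBounded_closedBall (x := (0 : Fin d → ℝ)) (r := 1)).subset fun v hv => ?_
  rw [mem_closedBall_zero_iff, pi_norm_le_iff_of_nonneg zero_le_one]
  intro i
  have h : v i * v i ≤ v ⬝ᵥ v :=
    Finset.single_le_sum (f := fun j => v j * v j) (fun j _ => mul_self_nonneg (v j))
      (Finset.mem_univ i)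
  rw [show v ⬝ᵥ v = 1 from hv] at h
  rw [Real.norm_eq_abs]
  exact abs_le_one_iff_mul_self_le_one.mpr h

lemma isCompact_rayleigh_values {d : ℕ} (M : Matrix (Fin d) (Fin d) ℝ) :
    IsCompact {r : ℝ | ∃ v : Fin d → ℝ, v ⬝ᵥ v = 1 ∧ r = v ⬝ᵥ (M *ᵥ v)} := by
  have h := (isCompact_unit_dotProduct d).image (f := fun v => v ⬝ᵥ (M *ᵥ v)) (by fun_prop)
  convert h using 1
  ext r
  simp only [Set.mem_ofPred_eq, Set.mem_image, eq_comm (a := r)]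

lemma exists_unit_smul {d : ℕ} (w : Fin d → ℝ) (hw : w ≠ 0) :
    ∃ u : Fin d → ℝ, u ⬝ᵥ u = 1 ∧ w = Real.sqrt (w ⬝ᵥ w) • u := by
  have hpos : 0 < w ⬝ᵥ w :=
    lt_of_le_of_ne (dotProduct_self_nonneg_real w) fun h => hw (dotProduct_self_eq_zero.mp h.symm)
  have hs : 0 < Real.sqrt (w ⬝ᵥ w) := Real.sqrt_pos.mpr hpos
  refine ⟨(Real.sqrt (w ⬝ᵥ w))⁻¹ • w, ?_, by rw [smul_inv_smul₀ hs.ne']⟩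
  rw [smul_dotProduct, dotProduct_smul, smul_eq_mul, smul_eq_mul, ← mul_assoc, ← mul_inv,
    Real.mul_self_sqrt hpos.le, inv_mul_cancel₀ hpos.ne']

lemma lambdaMin_mul_le {d : ℕ} (M : Matrix (Fin d) (Fin d) ℝ) (w : Fin d → ℝ) :
    lambdaMin M * (w ⬝ᵥ w) ≤ w ⬝ᵥ (M *ᵥ w) := by
  rcases eq_or_ne w 0 with rfl | hw
  · simp
  obtain ⟨u, hu, hwu⟩ := exists_unit_smul w hw
  have h : lambdaMin M ≤ u ⬝ᵥ (M *ᵥ u) :=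
    csInf_le (isCompact_rayleigh_values M).bddBelow ⟨u, hu, rfl⟩
  have := mul_le_mul_of_nonneg_left h (mul_self_nonneg (Real.sqrt (w ⬝ᵥ w)))
  generalize Real.sqrt (w ⬝ᵥ w) = s at *
  subst hwu
  simp only [mulVec_smul, smul_dotProduct, dotProduct_smul, smul_eq_mul, hu]
  linarith

lemma le_lambdaMax_mul {d : ℕ} (M : Matrix (Fin d) (Fin d) ℝ) (w : Fin d → ℝ) :
    w ⬝ᵥ (M *ᵥ w) ≤ lambdaMax M * (w ⬝ᵥ w) := by
  rcases eq_or_ne w 0 with rfl | hw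
  · simp
  obtain ⟨u, hu, hwu⟩ := exists_unit_smul w hw
  have h : u ⬝ᵥ (M *ᵥ u) ≤ lambdaMax M :=
    le_csSup (isCompact_rayleigh_values M).bddAbove ⟨u, hu, rfl⟩
  have := mul_le_mul_of_nonneg_left h (mul_self_nonneg (Real.sqrt (w ⬝ᵥ w)))
  generalize Real.sqrt (w ⬝ᵥ w) = s at *
  subst hwu
  simp only [mulVec_smul, smul_dotProduct, dotProduct_smul, smul_eq_mul, hu]
  linarith

lemma lambdaMin_pos {d : ℕ} (hd : 0 < d) {M : Matrix (Fin d) (Fin d) ℝ} (hM : M.PosDef) :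
    0 < lambdaMin M := by
  have hne : {r : ℝ | ∃ v : Fin d → ℝ, v ⬝ᵥ v = 1 ∧ r = v ⬝ᵥ (M *ᵥ v)}.Nonempty :=
    ⟨_, Pi.single ⟨0, hd⟩ 1, by simp, rfl⟩
  obtain ⟨u, hu, h⟩ := (isCompact_rayleigh_values M).sInf_mem hne
  have hu0 : u ≠ 0 := by
    rintro rfl
    simp at hu
  have hpos := hM.dotProduct_mulVec_pos hu0
  rw [star_trivial] at hpos
  rw [lambdaMin, h]
  exact hpos

lemma dotProduct_gram_mulVec {m δ : Type*} [Fintype m] [Fintype δ]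
    (A : Matrix m δ ℝ) (a b : δ → ℝ) :
    a ⬝ᵥ ((Aᵀ * A) *ᵥ b) = (A *ᵥ a) ⬝ᵥ (A *ᵥ b) := by
  rw [← mulVec_mulVec, dotProduct_mulVec, vecMul_transpose]

/-- The sketched Hessian agrees with the exact one up to relative error `χ / 2`. -/
lemma condA1.abs_sub_le {κ m δ : Type*} [Fintype κ] [Fintype m] [DecidableEq m] [Fintype δ]
    {A : Matrix m δ ℝ} {χ : ℝ} {k : ℕ} {B : Matrix κ m ℝ} (h : condA1 A χ k B) (a b : δ → ℝ) :
    |a ⬝ᵥ (((k : ℝ)⁻¹ • (Aᵀ * Bᵀ * B * A)) *ᵥ b) - a ⬝ᵥ ((Aᵀ * A) *ᵥ b)| ≤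
      (χ / 2) * Real.sqrt ((A *ᵥ a) ⬝ᵥ (A *ᵥ a)) * Real.sqrt ((A *ᵥ b) ⬝ᵥ (A *ᵥ b)) := by
  convert h (A *ᵥ a) b using 2
  rw [sub_mulVec, one_mulVec, dotProduct_sub, dotProduct_gram_mulVec]
  congr 1
  rw [smul_mulVec, smul_mulVec, dotProduct_smul, dotProduct_smul, mulVec_mulVec,
    ← vecMul_transpose A a, ← dotProduct_mulVec, mulVec_mulVec]
  simp only [Matrix.mul_assoc]

lemma condA1.isUnit_sketched_hessian {n d k : ℕ} {X : Matrix (Fin n) (Fin d) ℝ} {χ : ℝ}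
    {B : Matrix (Fin k) (Fin n) ℝ} (h : condA1 X χ k B) (hχ : χ < 2) (hM : (Xᵀ * X).PosDef) :
    IsUnit ((k : ℝ)⁻¹ • (Xᵀ * Bᵀ * B * X)) := by
  rw [← mulVec_injective_iff_isUnit, ← coe_mulVecLin, ← LinearMap.ker_eq_bot,
    LinearMap.ker_eq_bot']
  intro z hz
  rw [mulVecLin_apply] at hz
  by_contra hz0
  have hpos := hM.dotProduct_mulVec_pos hz0
  have hle := h.abs_sub_le z z
  rw [star_trivial] at hpos
  rw [hz, dotProduct_zero, zero_sub, abs_neg, abs_of_pos hpos, mul_assoc,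
    Real.mul_self_sqrt (dotProduct_self_nonneg_real _), ← dotProduct_gram_mulVec] at hle
  nlinarith

/-- One step of the noisy sketched Newton recursion contracts the Euclidean error by
`χ √κ / (2 - χ)`, up to a noise term. -/
lemma condA1.error_step_le {n d k : ℕ} {X : Matrix (Fin n) (Fin d) ℝ} {χ σ V : ℝ}
    {B : Matrix (Fin k) (Fin n) ℝ} (h : condA1 X χ k B) (hχ0 : 0 ≤ χ) (hχ : χ < 2) (hσ : 0 ≤ σ)
    (hl : 0 < lambdaMin (Xᵀ * X)) {e z v : Fin d → ℝ} (hv : Real.sqrt (v ⬝ᵥ v) ≤ V)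
    (hz : ((k : ℝ)⁻¹ • (Xᵀ * Bᵀ * B * X)) *ᵥ z =
      ((k : ℝ)⁻¹ • (Xᵀ * Bᵀ * B * X)) *ᵥ e - (Xᵀ * X) *ᵥ e + σ • v) :
    Real.sqrt (z ⬝ᵥ z) ≤
      χ * Real.sqrt (lambdaMax (Xᵀ * X) / lambdaMin (Xᵀ * X)) / (2 - χ) * Real.sqrt (e ⬝ᵥ e) +
        2 * σ / (2 - χ) * V / lambdaMin (Xᵀ * X) := by
  have hzz := (abs_le.mp (h.abs_sub_le z z)).1
  have hze := (abs_le.mp (h.abs_sub_le z e)).2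
  have hzv := (le_abs_self _).trans (abs_dotProduct_le_sqrt_mul_sqrt z v)
  have hmin := lambdaMin_mul_le (Xᵀ * X) z
  have hmax := le_lambdaMax_mul (Xᵀ * X) e
  have hzH := congrArg (z ⬝ᵥ ·) hz
  simp only [dotProduct_add, dotProduct_sub, dotProduct_smul, smul_eq_mul] at hzH
  rw [hzH] at hzz
  rw [dotProduct_gram_mulVec] at hmin hmax
  rw [dotProduct_gram_mulVec X z z] at hzz
  generalize lambdaMin (Xᵀ * X) = l at *
  generalize lambdaMax (Xᵀ * X) = L at *
  have hXz := Real.mul_self_sqrt (dotProduct_self_nonneg_real (X *ᵥ z))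
  have hXz0 := Real.sqrt_nonneg ((X *ᵥ z) ⬝ᵥ (X *ᵥ z))
  have hz0 := Real.sqrt_nonneg (z ⬝ᵥ z)
  have he0 := Real.sqrt_nonneg (e ⬝ᵥ e)
  have hmin' : Real.sqrt l * Real.sqrt (z ⬝ᵥ z) ≤ Real.sqrt ((X *ᵥ z) ⬝ᵥ (X *ᵥ z)) := by
    rw [← Real.sqrt_mul hl.le]
    exact Real.sqrt_le_sqrt hmin
  have hmax' : Real.sqrt ((X *ᵥ e) ⬝ᵥ (X *ᵥ e)) ≤ Real.sqrt L * Real.sqrt (e ⬝ᵥ e) := by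
    rw [← Real.sqrt_mul' _ (dotProduct_self_nonneg_real e)]
    exact Real.sqrt_le_sqrt hmax
  have hsl : 0 < Real.sqrt l := Real.sqrt_pos.mpr hl
  have hsl2 := Real.mul_self_sqrt hl.le
  have hsL := Real.sqrt_nonneg L
  have hv0 := (Real.sqrt_nonneg (v ⬝ᵥ v)).trans hv
  rw [Real.sqrt_div' _ hl.le]
  generalize Real.sqrt ((X *ᵥ z) ⬝ᵥ (X *ᵥ z)) = p at *
  generalize Real.sqrt ((X *ᵥ e) ⬝ᵥ (X *ᵥ e)) = q at *
  generalize Real.sqrt (z ⬝ᵥ z) = r at *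
  generalize Real.sqrt (e ⬝ᵥ e) = s at *
  generalize Real.sqrt l = a at *
  generalize Real.sqrt L = b at *
  have hV : σ * (z ⬝ᵥ v) ≤ σ * (r * V) := by gcongr; exact hzv.trans (by gcongr)
  have hquad : (1 - χ / 2) * (p * p) ≤ χ / 2 * p * q + σ * (r * V) := by
    rw [← hXz] at hzz
    linarith
  have hlin : (1 - χ / 2) * (a * p) ≤ χ / 2 * (a * (b * s)) + σ * V := by
    rcases hXz0.eq_or_lt with hp | hp
    · rw [← hp]
      have : 0 ≤ χ / 2 * (a * (b * s)) := by positivity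
      nlinarith [mul_nonneg hσ hv0]
    · refine le_of_mul_le_mul_right ?_ hp
      have h1 : a * (χ / 2 * p * q) ≤ a * (χ / 2 * p * (b * s)) := by gcongr
      have h2 : σ * V * (a * r) ≤ σ * V * p := by gcongr
      nlinarith [mul_le_mul_of_nonneg_left hquad hsl.le]
  have hfin : (1 - χ / 2) * (a * (a * r)) ≤ χ / 2 * (a * (b * s)) + σ * V :=
    le_trans (by gcongr; linarith) hlin
  have h2χ : 0 < 2 - χ := by linarith
  have hrhs : χ * (b / a) / (2 - χ) * s + 2 * σ / (2 - χ) * V / l =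
      (χ * a * b * s + 2 * σ * V) / ((2 - χ) * l) := by
    rw [← hsl2]
    field_simp
  rw [hrhs, le_div_iff₀ (by positivity), ← hsl2]
  linarith

/-- no-clipping guarantee. Under the stated sketching and noise conditions,
every iterate of the noisy iterative Hessian sketch recursion satisfies the stated
`ℓ∞` bound on its residual `Y − Xθ̂_t`. -/
theorem stmt10 {n d k : ℕ} (hk : 1 ≤ k) (T : ℕ) (hT : 1 ≤ T)
    (X : Matrix (Fin n) (Fin d) ℝ) (Y : Fin n → ℝ) (CY : ℝ)
    (hrow : ∀ i : Fin n, Real.sqrt (X i ⬝ᵥ X i) ≤ 1)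
    (hM : (Xᵀ * X).PosDef)
    (hY : ∀ i : Fin n, |Y i| ≤ CY)
    (χ ϱ : ℝ) (hχ : χ ∈ Set.Ioc (0 : ℝ) 1) (hϱ : ϱ ∈ Set.Ioc (0 : ℝ) 1)
    (σ : ℝ) (hσ : 0 ≤ σ)
    (hcond : χ * Real.sqrt (lambdaMax (Xᵀ * X) / lambdaMin (Xᵀ * X)) / (2 - χ) < 1)
    (B : Fin T → Matrix (Fin k) (Fin n) ℝ)
    (hB1 : ∀ t : Fin T, condA1 X χ k (B t))
    (hB2 : ∀ t : Fin T, condA2 X χ k (B t))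
    (v : Fin T → (Fin d → ℝ))
    (hv : ∀ t : Fin T,
      (v t) ⬝ᵥ (v t) ≤ (Real.sqrt (2 * d) + Real.sqrt (4 * Real.log (2 * T / ϱ))) ^ 2)
    (θ : ℕ → Fin d → ℝ) (hθ0 : θ 0 = 0)
    (hθ : ∀ t : Fin T,
      θ (t + 1) = θ t +
        ((k : ℝ)⁻¹ • (Xᵀ * (B t)ᵀ * (B t) * X))⁻¹ *ᵥ
          (Xᵀ *ᵥ (Y - X *ᵥ θ t) + σ • v t)) :
    ∀ t : ℕ, t ≤ T - 1 → ∀ i : Fin n,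
      |(Y - X *ᵥ θ t) i| ≤
        CY +
          (1 + (χ * Real.sqrt (lambdaMax (Xᵀ * X) / lambdaMin (Xᵀ * X)) / (2 - χ)) ^ t) *
            Real.sqrt (((Xᵀ * X)⁻¹ *ᵥ (Xᵀ *ᵥ Y)) ⬝ᵥ ((Xᵀ * X)⁻¹ *ᵥ (Xᵀ *ᵥ Y))) +
          (2 * σ / (2 - χ * (1 + Real.sqrt (lambdaMax (Xᵀ * X) / lambdaMin (Xᵀ * X))))) *
            (Real.sqrt (2 * d) + Real.sqrt (4 * Real.log (2 * T / ϱ))) /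
              lambdaMin (Xᵀ * X) := by
  intro t ht i
  obtain ⟨hχ0, hχ1⟩ := hχ
  set V := Real.sqrt (2 * d) + Real.sqrt (4 * Real.log (2 * T / ϱ)) with hVdef
  have hV0 : 0 ≤ V := by positivity
  rcases Nat.eq_zero_or_pos d with rfl | hd
  · have hl : lambdaMin (Xᵀ * X) = 0 := by
      simp [lambdaMin, dotProduct]
    rw [hl]
    simpa [mulVec, dotProduct] using hY i
  have hl := lambdaMin_pos hd hM
  set ρ := χ * Real.sqrt (lambdaMax (Xᵀ * X) / lambdaMin (Xᵀ * X)) / (2 - χ) with hρ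
  have hρ0 : 0 ≤ ρ := div_nonneg (by positivity) (by linarith)
  set φ := (Xᵀ * X)⁻¹ *ᵥ (Xᵀ *ᵥ Y) with hφ
  have hMφ : (Xᵀ * X) *ᵥ φ = Xᵀ *ᵥ Y := by
    rw [hφ, mulVec_mulVec, mul_nonsing_inv _ ((isUnit_iff_isUnit_det _).mp hM.isUnit), one_mulVec]
  have hnoise : 2 * σ / (2 - χ * (1 + Real.sqrt (lambdaMax (Xᵀ * X) / lambdaMin (Xᵀ * X)))) * V /
      lambdaMin (Xᵀ * X) = 2 * σ / (2 - χ) * V / lambdaMin (Xᵀ * X) / (1 - ρ) := by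
    have h2χ : 2 - χ ≠ 0 := by linarith
    have hden : 2 - χ * (1 + Real.sqrt (lambdaMax (Xᵀ * X) / lambdaMin (Xᵀ * X))) =
        (2 - χ) * (1 - ρ) := by
      rw [hρ]
      field_simp
      ring
    rw [hden, ← div_div, div_mul_eq_mul_div (2 * σ / (2 - χ)), div_right_comm]
  rw [hnoise]
  set N := 2 * σ / (2 - χ) * V / lambdaMin (Xᵀ * X) with hN
  have hN0 : 0 ≤ N := by
    have : 0 < 2 - χ := by linarith
    positivity
  have h1ρ : 0 < 1 - ρ := by linarith
  have herr : ∀ s : ℕ, s ≤ T - 1 → Real.sqrt ((θ s - φ) ⬝ᵥ (θ s - φ)) ≤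
      ρ ^ s * Real.sqrt (φ ⬝ᵥ φ) + N / (1 - ρ) := by
    intro s
    induction s with
    | zero =>
      intro _
      simpa [hθ0] using div_nonneg hN0 h1ρ.le
    | succ s ih =>
      intro hs
      have hstep := hθ ⟨s, by omega⟩
      have hu := (hB1 ⟨s, by omega⟩).isUnit_sketched_hessian (by linarith) hM
      have hle := (hB1 ⟨s, by omega⟩).error_step_le (e := θ s - φ) (z := θ (s + 1) - φ)
        (v := v ⟨s, by omega⟩) (V := V) hχ0.le (by linarith) hσ hl
        (Real.sqrt_le_iff.mpr ⟨hV0, hv _⟩) (by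
          rw [hstep, add_sub_right_comm, mulVec_add, mulVec_mulVec,
            mul_nonsing_inv _ ((isUnit_iff_isUnit_det _).mp hu), one_mulVec,
            mulVec_sub Xᵀ, mulVec_sub (Xᵀ * X), hMφ, mulVec_mulVec]
          abel)
      calc _ ≤ ρ * Real.sqrt ((θ s - φ) ⬝ᵥ (θ s - φ)) + N := hle
        _ ≤ ρ * (ρ ^ s * Real.sqrt (φ ⬝ᵥ φ) + N / (1 - ρ)) + N := by
          gcongr
          exact ih (by omega)
        _ = _ := by
          field_simp
          ring
  have htri := sqrt_dotProduct_self_add_le (θ t - φ) φ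
  rw [sub_add_cancel] at htri
  have hXθ : |(X *ᵥ θ t) i| ≤ Real.sqrt (θ t ⬝ᵥ θ t) :=
    (abs_dotProduct_le_sqrt_mul_sqrt (X i) (θ t)).trans
      (mul_le_of_le_one_left (Real.sqrt_nonneg _) (hrow i))
  have hsub : |(Y - X *ᵥ θ t) i| ≤ |Y i| + |(X *ᵥ θ t) i| := abs_sub _ _
  linarith [hY i, herr t ht]
end
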